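/- Let Λ ⊂ R^d be a Borel set, f a decreasing kernel with Cap_f(R^d) > 0, and ε > 0. Define the ε-averaged value f̄(ε) = ε^{−d}·d·∫₀^ε f(s)·s^{d−1} ds and the ε-smoothed kernel f_ε by f_ε(r) = f(r) for r ≥ ε and f_ε(r) = f̄(ε) for r < ε. Let Λ_ε = {x ∈ R^d : |x−y| < ε for some y ∈ Λ} be the ε-sausage about Λ. Then Cap_f(Λ_ε) ≍ Cap_{f_ε}(Λ), i.e., the ratio of the two capacities is bounded above and below by positive constants depending only on the dimension d (and not on Λ, f, or ε). -/

import Mathlib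

open MeasureTheory ProbabilityTheory Filter Set Asymptotics
open scoped ENNReal NNReal Topology InnerProductSpace

noncomputable section

/-- A decreasing kernel function `f : [0,∞) → [0,∞]` (encoded on all of `ℝ`), normalized
so that `f(0) = lim_{r ↓ 0} f(r)` whenever this limit is finite (in `ℝ≥0∞` the limit always
exists by monotonicity, and the condition is equivalent to `f` being right-continuous at `0`). -/
def IsKernel (f : ℝ → ℝ≥0∞) : Prop :=
  AntitoneOn f (Set.Ici 0) ∧ Filter.Tendsto f (𝓝[>] (0:ℝ)) (𝓝 (f 0))

/-- The `f`-energy of a measure: `E_f(ν) = ∫∫ f(|x−y|) dν(x) dν(y)`. -/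
def energy {X : Type*} [MeasurableSpace X] [PseudoMetricSpace X]
    (f : ℝ → ℝ≥0∞) (ν : Measure X) : ℝ≥0∞ :=
  ∫⁻ x, ∫⁻ y, f (dist x y) ∂ν ∂ν

/-- The `f`-capacity of a set: `Cap_f(Λ) = [inf_{ν(Λ)=1} E_f(ν)]⁻¹`, the infimum running over
Borel probability measures giving full mass to `Λ`. -/
def capacity {X : Type*} [MeasurableSpace X] [PseudoMetricSpace X]
    (f : ℝ → ℝ≥0∞) (Λ : Set X) : ℝ≥0∞ :=
  (⨅ (ν : Measure X) (_ : IsProbabilityMeasure ν) (_ : ν Λ = 1), energy f ν)⁻¹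

/-- The `ε`-averaged kernel value `f̄(ε) = ε^{−d}·d·∫₀^ε f(s)·s^{d−1} ds`. -/
def kernelAvg (d : ℕ) (f : ℝ → ℝ≥0∞) (ε : ℝ) : ℝ≥0∞ :=
  ((ENNReal.ofReal ε) ^ d)⁻¹ * d *
    ∫⁻ s in Set.Ioo (0:ℝ) ε, f s * ENNReal.ofReal (s ^ (d - 1))

/-- The `ε`-smoothed kernel `f_ε`: equal to `f(r)` for `r ≥ ε`, and to `f̄(ε)` for `r < ε`. -/
def smoothedKernel (d : ℕ) (f : ℝ → ℝ≥0∞) (ε : ℝ) : ℝ → ℝ≥0∞ :=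
  fun r => if r < ε then kernelAvg d f ε else f r

theorem lintegral_eq_lintegral_measure_ofReal_lt {α : Type*} [MeasurableSpace α] {μ : Measure α}
    [SFinite μ] {f : α → ℝ≥0∞} (hf : Measurable f) :
    ∫⁻ x, f x ∂μ = ∫⁻ t in Ioi (0 : ℝ), μ {x | ENNReal.ofReal t < f x} := by
  have key : ∀ a : ℝ≥0∞, ∫⁻ t in Ioi (0 : ℝ), {t | ENNReal.ofReal t < a}.indicator 1 t = a := by
    intro a
    rw [lintegral_indicator_one (measurableSet_lt ENNReal.measurable_ofReal measurable_const),
      Measure.restrict_apply (measurableSet_lt ENNReal.measurable_ofReal measurable_const)]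
    rcases eq_or_ne a ⊤ with rfl | ha
    · simp
    · have : {t | ENNReal.ofReal t < a} ∩ Ioi 0 = Ioo 0 a.toReal := by
        ext t
        simp only [mem_inter_iff, mem_ofPred_eq, mem_Ioi, mem_Ioo]
        constructor
        · rintro ⟨h1, h2⟩
          exact ⟨h2, (ENNReal.ofReal_lt_iff_lt_toReal h2.le ha).1 h1⟩
        · rintro ⟨h1, h2⟩
          exact ⟨(ENNReal.ofReal_lt_iff_lt_toReal h1.le ha).2 h2, h1⟩
      rw [this, Real.volume_Ioo, sub_zero, ENNReal.ofReal_toReal ha]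
  have hm : MeasurableSet {p : α × ℝ | ENNReal.ofReal p.2 < f p.1} :=
    measurableSet_lt (by fun_prop) (by fun_prop)
  calc ∫⁻ x, f x ∂μ
      = ∫⁻ x, (∫⁻ t in Ioi (0 : ℝ), {t | ENNReal.ofReal t < f x}.indicator 1 t) ∂μ := by
        simp_rw [key]
    _ = ∫⁻ t in Ioi (0 : ℝ), (∫⁻ x, {t | ENNReal.ofReal t < f x}.indicator 1 t ∂μ) := by
        refine lintegral_lintegral_swap
          (f := fun (x : α) (t : ℝ) => {t | ENNReal.ofReal t < f x}.indicator 1 t)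
          (Measurable.aemeasurable ?_)
        exact (measurable_one (α := ℝ≥0∞) (β := α × ℝ)).indicator hm
    _ = _ := by
        refine lintegral_congr fun t => ?_
        rw [← lintegral_indicator_one (measurableSet_lt measurable_const hf)]
        rfl

/-- Comparison of two measures on initial segments gives a comparison of the integrals of
all decreasing functions. -/
theorem lintegral_le_mul_lintegral_of_isLowerSet {α β : Measure ℝ} [SFinite α] [SFinite β]
    {C : ℝ≥0∞} (hC : C ≠ ⊤)
    (h : ∀ D : Set ℝ, IsLowerSet D → MeasurableSet D → α D ≤ C * β D)
    {f : ℝ → ℝ≥0∞} (hf : Antitone f) : ∫⁻ r, f r ∂α ≤ C * ∫⁻ r, f r ∂β := by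
  rw [lintegral_eq_lintegral_measure_ofReal_lt hf.measurable,
    lintegral_eq_lintegral_measure_ofReal_lt hf.measurable, ← lintegral_const_mul' _ _ hC]
  refine lintegral_mono fun t => h _ (fun a b hab ha => lt_of_lt_of_le ha (hf hab)) ?_
  exact measurableSet_lt measurable_const hf.measurable

theorem prod_self_sub_mem_le {X G : Type*} [MeasurableSpace X] [AddCommGroup G] [Countable G]
    [MeasurableSpace G] [DiscreteMeasurableSpace G] (μ : Measure X) [SFinite μ] {q : X → G}
    (hq : Measurable q) (F : Finset G) :
    (μ.prod μ) {p | q p.1 - q p.2 ∈ F} ≤ 2 * F.card * (μ.prod μ) {p | q p.1 = q p.2} := by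
  have formula : ∀ m : G, (μ.prod μ) {p | q p.1 - q p.2 = m} =
      ∑' k, μ.map q {k - m} * μ.map q {k} := by
    intro m
    have hS : MeasurableSet {p : X × X | q p.1 - q p.2 = m} := by
      have : Measurable fun p : X × X => (q p.1, q p.2) := by fun_prop
      exact this (t := {g | g.1 - g.2 = m}) (Set.to_countable _).measurableSet
    rw [Measure.prod_apply hS, ← lintegral_countable',
      lintegral_map (measurable_of_countable _) hq]
    refine lintegral_congr fun x => ?_
    rw [Measure.map_apply hq (measurableSet_singleton _)]
    congr 1
    ext y
    simp only [mem_preimage, mem_ofPred_eq, mem_singleton_iff]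
    constructor
    · rintro rfl; abel
    · intro h; rw [h]; abel
  have h0 : (μ.prod μ) {p | q p.1 = q p.2} = ∑' k, μ.map q {k} * μ.map q {k} := by
    have := formula 0
    simpa [sub_eq_zero] using this
  have hm : ∀ m : G, (μ.prod μ) {p | q p.1 - q p.2 = m} ≤
      2 * (μ.prod μ) {p | q p.1 = q p.2} := by
    intro m
    rw [formula, h0]
    calc ∑' k, μ.map q {k - m} * μ.map q {k}
        ≤ ∑' k, (μ.map q {k - m} * μ.map q {k - m} + μ.map q {k} * μ.map q {k}) := by
          refine ENNReal.tsum_le_tsum fun k => ?_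
          rcases le_total (μ.map q {k - m}) (μ.map q {k}) with h | h
          · exact le_add_left (mul_le_mul_left h _)
          · exact le_add_right (mul_le_mul_right h _)
      _ = _ := by
          rw [ENNReal.tsum_add, two_mul]
          congr 1
          exact (Equiv.subRight m).tsum_eq (fun k => μ.map q {k} * μ.map q {k})
  have hU : {p : X × X | q p.1 - q p.2 ∈ F} = ⋃ m ∈ F, {p | q p.1 - q p.2 = m} := by
    ext p; simp
  rw [hU]
  calc _ ≤ ∑ m ∈ F, (μ.prod μ) {p | q p.1 - q p.2 = m} := measure_biUnion_finset_le _ _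
    _ ≤ ∑ m ∈ F, 2 * (μ.prod μ) {p | q p.1 = q p.2} := Finset.sum_le_sum fun m _ => hm m
    _ = _ := by rw [Finset.sum_const, nsmul_eq_mul]; ring

/-- The cell of the cubic grid of mesh `s` containing a given point. -/
def gridCell {d : ℕ} (s : ℝ) (x : EuclideanSpace ℝ (Fin d)) : Fin d → ℤ := fun i => ⌊x i / s⌋

theorem measurable_gridCell {d : ℕ} (s : ℝ) :
    Measurable (gridCell s : EuclideanSpace ℝ (Fin d) → Fin d → ℤ) := by
  refine measurable_pi_lambda _ fun i => Int.measurable_floor.comp ?_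
  fun_prop

theorem EuclideanSpace.dist_lt_mul_of_forall_lt {d : ℕ} (hd : 1 ≤ d) {s : ℝ}
    {x y : EuclideanSpace ℝ (Fin d)} (h : ∀ i, |x i - y i| < s) : dist x y < d * s := by
  have hne : Nonempty (Fin d) := ⟨⟨0, hd⟩⟩
  have hs : 0 < s := (abs_nonneg _).trans_lt (h (Classical.arbitrary _))
  have hd' : (1 : ℝ) ≤ d := by exact_mod_cast hd
  rw [EuclideanSpace.dist_eq, Real.sqrt_lt' (by positivity)]
  calc ∑ i, dist (x i) (y i) ^ 2 < ∑ i : Fin d, s ^ 2 := by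
        refine Finset.sum_lt_sum_of_nonempty Finset.univ_nonempty fun i _ => ?_
        rw [Real.dist_eq]
        exact pow_lt_pow_left₀ (h i) (abs_nonneg _) two_ne_zero
    _ = d * s ^ 2 := by simp
    _ ≤ (d * s) ^ 2 := by
        rw [mul_pow]
        gcongr
        nlinarith

theorem dist_lt_of_gridCell_eq {d : ℕ} (hd : 1 ≤ d) {s : ℝ} (hs : 0 < s)
    {x y : EuclideanSpace ℝ (Fin d)} (h : gridCell s x = gridCell s y) : dist x y < d * s := by
  refine EuclideanSpace.dist_lt_mul_of_forall_lt hd fun i => ?_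
  have h1 := Int.abs_sub_lt_one_of_floor_eq_floor (congrFun h i)
  rwa [← sub_div, abs_div, abs_of_pos hs, div_lt_one hs] at h1

theorem abs_gridCell_sub_le {d : ℕ} {s T : ℝ} (hs : 0 < s)
    {x y : EuclideanSpace ℝ (Fin d)} (h : dist x y ≤ T) (i : Fin d) :
    |gridCell s x i - gridCell s y i| ≤ ⌊T / s⌋ + 1 := by
  have h1 : |x i - y i| ≤ T := by
    have := PiLp.norm_apply_le (x - y) i
    rw [← dist_eq_norm] at this
    exact (this.trans h)
  have h2 : |x i / s - y i / s| ≤ T / s := by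
    rw [← sub_div, abs_div, abs_of_pos hs]; gcongr
  rw [abs_le] at h2
  have e1 := Int.floor_le (x i / s)
  have e2 := Int.lt_floor_add_one (x i / s)
  have e3 := Int.floor_le (y i / s)
  have e4 := Int.lt_floor_add_one (y i / s)
  have e5 := Int.lt_floor_add_one (T / s)
  unfold gridCell
  rw [abs_le]
  constructor
  · have : (-(⌊T / s⌋ + 1) : ℝ) < ⌊x i / s⌋ - ⌊y i / s⌋ + 1 := by linarith
    have : (-(⌊T / s⌋ + 1)) < ⌊x i / s⌋ - ⌊y i / s⌋ + 1 := by exact_mod_cast this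
    linarith
  · have : (⌊x i / s⌋ - ⌊y i / s⌋ : ℝ) < ⌊T / s⌋ + 1 + 1 := by linarith
    have : (⌊x i / s⌋ - ⌊y i / s⌋) < ⌊T / s⌋ + 1 + 1 := by exact_mod_cast this
    linarith

/-- Polynomial volume growth of pair distances, uniformly over all measures. -/
theorem prod_self_dist_le_le {d : ℕ} (hd : 1 ≤ d) (μ : Measure (EuclideanSpace ℝ (Fin d)))
    [SFinite μ] {R T : ℝ} (hR : 0 < R) (hRT : R ≤ T) :
    (μ.prod μ) {p | dist p.1 p.2 ≤ T} ≤
      ENNReal.ofReal (2 * ((2 * d + 3) * (T / R)) ^ d) * (μ.prod μ) {p | dist p.1 p.2 < R} := by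
  have hd' : (1 : ℝ) ≤ d := by exact_mod_cast hd
  set s := R / d with hs_def
  have hs : 0 < s := by positivity
  have hds : d * s = R := by rw [hs_def]; field_simp
  set K := ⌊T / s⌋ + 1 with hK
  have hTs : T / s = d * (T / R) := by rw [hs_def]; field_simp
  have hTR : 1 ≤ T / R := (one_le_div hR).2 hRT
  have hK0 : 0 ≤ K := by
    have : 0 ≤ ⌊T / s⌋ := Int.floor_nonneg.2 (div_nonneg (hR.le.trans hRT) hs.le)
    omega
  set F : Finset (Fin d → ℤ) := Fintype.piFinset fun _ => Finset.Icc (-K) K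
  have hF : (F.card : ℝ) ≤ ((2 * d + 3) * (T / R)) ^ d := by
    rw [Fintype.card_piFinset_const, Int.card_Icc, Nat.cast_pow]
    gcongr
    have : ((K + 1 - -K).toNat : ℝ) = 2 * K + 1 := by
      have : ((K + 1 - -K).toNat : ℤ) = 2 * K + 1 := by omega
      exact_mod_cast this
    rw [this]
    have h1 := Int.floor_le (T / s)
    have h2 : (K : ℝ) = ⌊T / s⌋ + 1 := by rw [hK]; push_cast; rfl
    rw [h2]
    nlinarith
  calc (μ.prod μ) {p | dist p.1 p.2 ≤ T}
      ≤ (μ.prod μ) {p | gridCell s p.1 - gridCell s p.2 ∈ F} := by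
        refine measure_mono fun p hp => ?_
        simp only [mem_ofPred_eq, F, Fintype.mem_piFinset, Finset.mem_Icc, ← abs_le, Pi.sub_apply]
        exact fun i => abs_gridCell_sub_le hs hp i
    _ ≤ 2 * F.card * (μ.prod μ) {p | gridCell s p.1 = gridCell s p.2} :=
        prod_self_sub_mem_le μ (measurable_gridCell s) F
    _ ≤ _ := by
        gcongr with p
        · rw [ENNReal.ofReal_mul zero_le_two, ENNReal.ofReal_ofNat]
          gcongr
          rw [← ENNReal.ofReal_natCast]
          exact ENNReal.ofReal_le_ofReal hF
        · intro hp
          exact hds ▸ dist_lt_of_gridCell_eq hd hs hp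

theorem energy_eq_lintegral_map_dist {X : Type*} [MeasurableSpace X] [PseudoMetricSpace X]
    [OpensMeasurableSpace X] [SecondCountableTopology X] (μ : Measure X) [SFinite μ]
    {f : ℝ → ℝ≥0∞} (hf : Measurable f) :
    energy f μ = ∫⁻ r, f r ∂(μ.prod μ).map (fun p => dist p.1 p.2) := by
  rw [lintegral_map hf (by fun_prop), lintegral_prod _ (by fun_prop)]
  rfl

/-- Contracting the argument of a decreasing kernel changes the energy by a bounded factor. -/
theorem energy_div_le {d : ℕ} (hd : 1 ≤ d) (μ : Measure (EuclideanSpace ℝ (Fin d)))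
    [SFinite μ] {f : ℝ → ℝ≥0∞} (hf : Antitone f) {M : ℝ} (hM : 1 ≤ M) :
    energy (fun r => f (r / M)) μ ≤
      ENNReal.ofReal (2 * ((2 * d + 3) * M) ^ d) * energy f μ := by
  have hM0 : 0 < M := zero_lt_one.trans_le hM
  have hd' : (1 : ℝ) ≤ d := by exact_mod_cast hd
  have hC1 : 1 ≤ ENNReal.ofReal (2 * ((2 * d + 3) * M) ^ d) := by
    rw [ENNReal.one_le_ofReal]
    have : 1 ≤ ((2 * d + 3) * M) ^ d := one_le_pow₀ (by nlinarith)
    linarith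
  rw [energy_eq_lintegral_map_dist μ hf.measurable, energy_eq_lintegral_map_dist μ
    (f := fun r => f (r / M))
    (hf.measurable.comp (measurable_id.div_const M)),
    ← lintegral_map (f := f) (g := fun r => r / M) hf.measurable (by fun_prop),
    Measure.map_map (by fun_prop) (by fun_prop)]
  refine lintegral_le_mul_lintegral_of_isLowerSet ENNReal.ofReal_ne_top (fun D hD hDm => ?_) hf
  rw [Measure.map_apply (by fun_prop) hDm, Measure.map_apply (by fun_prop) hDm]
  have triv : ∀ {S S' : Set (EuclideanSpace ℝ (Fin d) × EuclideanSpace ℝ (Fin d))}, S ⊆ S' →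
      (μ.prod μ) S ≤ ENNReal.ofReal (2 * ((2 * d + 3) * M) ^ d) * (μ.prod μ) S' := fun h =>
    (measure_mono h).trans (le_mul_of_one_le_left' hC1)
  rcases D.eq_empty_or_nonempty with rfl | hne
  · exact triv (by simp)
  by_cases hb : BddAbove D
  · rcases le_or_gt (sSup D) 0 with hR | hR
    · refine triv fun p hp => ?_
      have h1 : dist p.1 p.2 / M ≤ 0 := (le_csSup hb hp).trans hR
      have h2 : dist p.1 p.2 = 0 :=
        le_antisymm (by simpa using (div_le_iff₀ hM0).1 h1) dist_nonneg
      simpa [h2] using hp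
    · have hMR : sSup D ≤ M * sSup D := le_mul_of_one_le_left hR.le hM
      have := prod_self_dist_le_le hd μ hR hMR
      rw [mul_div_assoc, div_self hR.ne', mul_one] at this
      refine (measure_mono fun p hp => ?_).trans (this.trans ?_)
      · have h1 : dist p.1 p.2 / M ≤ sSup D := le_csSup hb hp
        simpa [mul_comm] using (div_le_iff₀ hM0).1 h1
      · gcongr
        intro p hp
        obtain ⟨r, hr, hpr⟩ := exists_lt_of_lt_csSup hne hp
        exact hD hpr.le hr
  · refine triv fun p _ => ?_
    rw [not_bddAbove_iff] at hb
    obtain ⟨r, hr, hpr⟩ := hb (dist p.1 p.2)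
    exact hD hpr.le hr

theorem lintegral_fun_norm_addHaar {E : Type*} [NormedAddCommGroup E] [NormedSpace ℝ E]
    [MeasurableSpace E] [BorelSpace E] [FiniteDimensional ℝ E] [Nontrivial E] (μ : Measure E)
    [μ.IsAddHaarMeasure] {f : ℝ → ℝ≥0∞} (hf : Measurable f) :
    ∫⁻ x, f ‖x‖ ∂μ = Module.finrank ℝ E * μ (Metric.ball 0 1) *
      ∫⁻ r in Ioi (0 : ℝ), f r * ENNReal.ofReal (r ^ (Module.finrank ℝ E - 1)) := by
  calc ∫⁻ x, f ‖x‖ ∂μ = ∫⁻ x : ({0}ᶜ : Set E), f ‖x.1‖ ∂(μ.comap (↑)) := by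
        rw [lintegral_subtype_comap (measurableSet_singleton _).compl fun x => f ‖x‖,
          restrict_compl_singleton]
    _ = ∫⁻ x, f x.2 ∂μ.toSphere.prod (.volumeIoiPow (Module.finrank ℝ E - 1)) := by
        simpa using μ.measurePreserving_homeomorphUnitSphereProd.lintegral_comp_emb
          (Homeomorph.measurableEmbedding _) (f ∘ Subtype.val ∘ Prod.snd)
    _ = μ.toSphere univ *
          ∫⁻ x : Ioi (0 : ℝ), f x ∂.volumeIoiPow (Module.finrank ℝ E - 1) := by
        rw [lintegral_prod _ (by fun_prop)]
        simp [mul_comm]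
    _ = _ := by
        rw [μ.toSphere_apply_univ, Measure.volumeIoiPow,
          lintegral_withDensity_eq_lintegral_mul _ (by fun_prop) (by fun_prop)]
        simp only [Pi.mul_apply]
        rw [lintegral_subtype_comap measurableSet_Ioi
          fun r => ENNReal.ofReal (r ^ (Module.finrank ℝ E - 1)) * f r]
        simp_rw [mul_comm (f _)]

section Smoothing

variable {d : ℕ}

theorem kernelAvg_eq_lintegral_cond (hd : 1 ≤ d) {f : ℝ → ℝ≥0∞} (hf : Measurable f)
    {ε : ℝ} (hε : 0 < ε) :
    kernelAvg d f ε =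
      ∫⁻ u, f ‖u‖ ∂ProbabilityTheory.cond volume (Metric.ball (0 : EuclideanSpace ℝ (Fin d)) ε) := by
  have : Nonempty (Fin d) := ⟨⟨0, hd⟩⟩
  have hball : ∫⁻ u in Metric.ball (0 : EuclideanSpace ℝ (Fin d)) ε, f ‖u‖ =
      d * volume (Metric.ball (0 : EuclideanSpace ℝ (Fin d)) 1) *
        ∫⁻ s in Ioo (0 : ℝ) ε, f s * ENNReal.ofReal (s ^ (d - 1)) := by
    have h := lintegral_fun_norm_addHaar (volume : Measure (EuclideanSpace ℝ (Fin d)))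
      (hf.indicator (measurableSet_Iio (a := ε)))
    rw [finrank_euclideanSpace_fin] at h
    rw [← lintegral_indicator measurableSet_ball]
    convert h using 2
    · ext u
      by_cases hu : ‖u‖ < ε <;> simp [hu]
    · rw [← Ioi_inter_Iio, inter_comm, ← setLIntegral_indicator measurableSet_Iio]
      congr 1
      ext s
      by_cases hs : s < ε <;> simp [hs]
  have hv0 : volume (Metric.ball (0 : EuclideanSpace ℝ (Fin d)) 1) ≠ 0 :=
    (Metric.measure_ball_pos _ _ one_pos).ne'
  have hvt : volume (Metric.ball (0 : EuclideanSpace ℝ (Fin d)) 1) ≠ ⊤ := measure_ball_lt_top.ne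
  rw [ProbabilityTheory.cond, lintegral_smul_measure, hball, Measure.addHaar_ball _ _ hε.le,
    finrank_euclideanSpace_fin, smul_eq_mul, ENNReal.mul_inv (.inr hvt) (.inr hv0), kernelAvg,
    ENNReal.ofReal_pow hε.le]
  set v := volume (Metric.ball (0 : EuclideanSpace ℝ (Fin d)) 1)
  calc _ = (v⁻¹ * v) * ((ENNReal.ofReal ε ^ d)⁻¹ * d *
        ∫⁻ s in Ioo (0 : ℝ) ε, f s * ENNReal.ofReal (s ^ (d - 1))) := by
        rw [ENNReal.inv_mul_cancel hv0 hvt, one_mul]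
    _ = _ := by ring

theorem isProbabilityMeasure_cond_ball {ε : ℝ} (hε : 0 < ε) :
    IsProbabilityMeasure (ProbabilityTheory.cond volume (Metric.ball (0 : EuclideanSpace ℝ (Fin d)) ε)) :=
  cond_isProbabilityMeasure_of_finite (Metric.measure_ball_pos _ _ hε).ne' measure_ball_lt_top.ne

theorem ae_cond_ball_norm_lt {ε : ℝ} :
    ∀ᵐ u ∂ProbabilityTheory.cond volume (Metric.ball (0 : EuclideanSpace ℝ (Fin d)) ε), ‖u‖ < ε := by
  filter_upwards [ae_cond_mem measurableSet_ball] with u hu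
  simpa using hu

theorem le_kernelAvg (hd : 1 ≤ d) {f : ℝ → ℝ≥0∞} (hf : Antitone f) {ε : ℝ} (hε : 0 < ε) :
    f ε ≤ kernelAvg d f ε := by
  have := isProbabilityMeasure_cond_ball (d := d) hε
  rw [kernelAvg_eq_lintegral_cond hd hf.measurable hε]
  calc f ε = ∫⁻ _, f ε ∂ProbabilityTheory.cond volume (Metric.ball (0 : EuclideanSpace ℝ (Fin d)) ε) := by simp
    _ ≤ _ := lintegral_mono_ae (ae_cond_ball_norm_lt.mono fun u hu => hf hu.le)

theorem antitone_smoothedKernel (hd : 1 ≤ d) {f : ℝ → ℝ≥0∞} (hf : Antitone f) {ε : ℝ}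
    (hε : 0 < ε) : Antitone (smoothedKernel d f ε) := by
  intro a b hab
  unfold smoothedKernel
  split_ifs with h1 h2 h2
  · exact le_rfl
  · exact absurd (hab.trans_lt h1) h2
  · exact (hf (not_lt.1 h1)).trans (le_kernelAvg hd hf hε)
  · exact hf hab

/-- Among all translates of a ball, the centred one has the largest integral of a radially
decreasing function. -/
theorem setLIntegral_ball_norm_sub_le {f : ℝ → ℝ≥0∞} (hf : Antitone f) {ε : ℝ}
    (w : EuclideanSpace ℝ (Fin d)) :
    ∫⁻ v in Metric.ball (0 : EuclideanSpace ℝ (Fin d)) ε, f ‖w - v‖ ≤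
      ∫⁻ v in Metric.ball (0 : EuclideanSpace ℝ (Fin d)) ε, f ‖v‖ := by
  have hfm := hf.measurable
  set A := Metric.ball w ε
  set B := Metric.ball (0 : EuclideanSpace ℝ (Fin d)) ε
  have hpre : (fun v => w - v) ⁻¹' A = B := by
    ext v; simp [A, B, dist_eq_norm]
  have htrans : ∫⁻ v in B, f ‖w - v‖ = ∫⁻ v in A, f ‖v‖ := by
    rw [← hpre]
    exact (Measure.measurePreserving_sub_left volume w).setLIntegral_comp_preimage measurableSet_ball
      (f := fun v => f ‖v‖) (by fun_prop)
  have hvol : volume (A \ B) = volume (B \ A) := by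
    have h1 := measure_sdiff_add_inter (μ := volume) A (measurableSet_ball : MeasurableSet B)
    have h2 := measure_sdiff_add_inter (μ := volume) B (measurableSet_ball : MeasurableSet A)
    have h3 : volume A = volume B := Measure.addHaar_ball_center _ _ _
    have hfin : volume (A ∩ B) ≠ ⊤ :=
      ((measure_mono inter_subset_right).trans_lt measure_ball_lt_top).ne
    rw [inter_comm B A, ← h3, ← h1] at h2
    exact ((ENNReal.add_left_inj hfin).1 h2).symm
  rw [htrans, ← lintegral_inter_add_sdiff _ A (measurableSet_ball : MeasurableSet B),
    ← lintegral_inter_add_sdiff _ B (measurableSet_ball : MeasurableSet A), inter_comm B A]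
  gcongr 1
  calc ∫⁻ v in A \ B, f ‖v‖ ≤ ∫⁻ _ in A \ B, f ε :=
        setLIntegral_mono measurable_const fun v hv => hf (by simpa [B] using hv.2)
    _ = ∫⁻ _ in B \ A, f ε := by simp [hvol]
    _ ≤ ∫⁻ v in B \ A, f ‖v‖ :=
        setLIntegral_mono (by fun_prop) fun v hv =>
          hf (le_of_lt (by simpa [B] using hv.1))

/-- Convolving a measure with the uniform measure on a ball controls its energy by the energy
of the original measure for the smoothed kernel, up to a dilation. -/
theorem energy_conv_cond_ball_le (hd : 1 ≤ d) {f : ℝ → ℝ≥0∞} (hf : Antitone f) {ε : ℝ}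
    (hε : 0 < ε) (ν : Measure (EuclideanSpace ℝ (Fin d))) [SFinite ν] :
    energy f (ν ∗ ProbabilityTheory.cond volume (Metric.ball (0 : EuclideanSpace ℝ (Fin d)) ε)) ≤
      energy (fun r => smoothedKernel d f ε (r / 4)) ν := by
  have hprob := isProbabilityMeasure_cond_ball (d := d) hε
  have hfm := hf.measurable
  set κ := ProbabilityTheory.cond volume (Metric.ball (0 : EuclideanSpace ℝ (Fin d)) ε) with hκ
  have inner : ∀ x y u : EuclideanSpace ℝ (Fin d), ‖u‖ < ε →
      ∫⁻ v, f (dist (x + u) (y + v)) ∂κ ≤ smoothedKernel d f ε (dist x y / 4) := by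
    intro x y u hu
    unfold smoothedKernel
    split_ifs with h
    · rw [kernelAvg_eq_lintegral_cond hd hfm hε, hκ, ProbabilityTheory.cond, lintegral_smul_measure,
        lintegral_smul_measure]
      simp_rw [dist_eq_norm, ← sub_sub]
      exact smul_le_smul_of_nonneg_left (setLIntegral_ball_norm_sub_le hf _) zero_le
    · calc ∫⁻ v, f (dist (x + u) (y + v)) ∂κ ≤ ∫⁻ _, f (dist x y / 4) ∂κ := by
            refine lintegral_mono_ae (ae_cond_ball_norm_lt.mono fun v hv => hf ?_)
            have h1 : dist x y ≤ dist (x + u) (y + v) + ‖u‖ + ‖v‖ := by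
              calc dist x y ≤ dist x (x + u) + dist (x + u) (y + v) + dist (y + v) y :=
                    dist_triangle4 _ _ _ _
                _ = _ := by simp [dist_eq_norm]; ring
            linarith
        _ = _ := by simp
  have hm : Measurable fun z : EuclideanSpace ℝ (Fin d) => ∫⁻ w, f (dist z w) ∂(ν ∗ κ) :=
    Measurable.lintegral_prod_right' (f := fun p : EuclideanSpace ℝ (Fin d) ×
      EuclideanSpace ℝ (Fin d) => f (dist p.1 p.2)) (by fun_prop)
  unfold energy
  rw [Measure.lintegral_conv hm]
  refine lintegral_mono fun x => ?_
  calc ∫⁻ u, ∫⁻ w, f (dist (x + u) w) ∂(ν ∗ κ) ∂κ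
      ≤ ∫⁻ _, ∫⁻ y, smoothedKernel d f ε (dist x y / 4) ∂ν ∂κ := by
        refine lintegral_mono_ae (ae_cond_ball_norm_lt.mono fun u hu => ?_)
        rw [Measure.lintegral_conv (by fun_prop)]
        exact lintegral_mono fun y => inner x y u hu
    _ = _ := by simp

theorem conv_cond_ball_thickening {ε : ℝ} (hε : 0 < ε)
    {Λ : Set (EuclideanSpace ℝ (Fin d))} (hΛ : MeasurableSet Λ)
    (ν : Measure (EuclideanSpace ℝ (Fin d))) [IsProbabilityMeasure ν] (hν : ν Λ = 1) :
    (ν ∗ ProbabilityTheory.cond volume (Metric.ball (0 : EuclideanSpace ℝ (Fin d)) ε))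
      (Metric.thickening ε Λ) = 1 := by
  have hprob := isProbabilityMeasure_cond_ball (d := d) hε
  have hT : MeasurableSet (Metric.thickening ε Λ) := Metric.isOpen_thickening.measurableSet
  have hae : ∀ᵐ x ∂ν, x ∈ Λ := (mem_ae_iff_prob_eq_one hΛ).2 hν
  rw [← lintegral_indicator_one hT,
    Measure.lintegral_conv (measurable_one.indicator hT)]
  calc _ = ∫⁻ _, (∫⁻ _, 1 ∂ProbabilityTheory.cond volume (Metric.ball (0 : EuclideanSpace ℝ (Fin d)) ε)) ∂ν := by
        refine lintegral_congr_ae (hae.mono fun x hx => ?_)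
        refine lintegral_congr_ae (ae_cond_ball_norm_lt.mono fun u hu => ?_)
        refine indicator_of_mem (Metric.mem_thickening_iff.2 ⟨x, hx, ?_⟩) _
        simpa [dist_eq_norm] using hu
    _ = 1 := by simp

/-- Up to a constant, the uniform measure on a ball of radius `ε` is the most favourable way
of spreading mass over pair distances below `ε`. -/
theorem kernelAvg_mul_measure_le (hd : 1 ≤ d) {f : ℝ → ℝ≥0∞} (hf : Antitone f) {ε : ℝ}
    (hε : 0 < ε) (μ : Measure (EuclideanSpace ℝ (Fin d))) [IsFiniteMeasure μ] :
    (μ.prod μ) {p | dist p.1 p.2 < ε} * kernelAvg d f ε ≤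
      ENNReal.ofReal (2 * (2 * d + 3) ^ d) * energy f μ := by
  have : Nonempty (Fin d) := ⟨⟨0, hd⟩⟩
  have hprob := isProbabilityMeasure_cond_ball (d := d) hε
  have hfm := hf.measurable
  set κ := ProbabilityTheory.cond volume (Metric.ball (0 : EuclideanSpace ℝ (Fin d)) ε) with hκ
  set P := (μ.prod μ) {p | dist p.1 p.2 < ε}
  have hclosed : ∀ R, 0 ≤ R → κ (Metric.closedBall 0 R) ≤ ENNReal.ofReal ((R / ε) ^ d) := by
    intro R hR
    have hv0 : volume (Metric.ball (0 : EuclideanSpace ℝ (Fin d)) 1) ≠ 0 :=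
      (Metric.measure_ball_pos _ _ one_pos).ne'
    have hvt : volume (Metric.ball (0 : EuclideanSpace ℝ (Fin d)) 1) ≠ ⊤ := measure_ball_lt_top.ne
    calc κ (Metric.closedBall 0 R)
        ≤ (volume (Metric.ball (0 : EuclideanSpace ℝ (Fin d)) ε))⁻¹ *
            volume (Metric.closedBall (0 : EuclideanSpace ℝ (Fin d)) R) := by
          rw [hκ, ProbabilityTheory.cond, Measure.smul_apply, smul_eq_mul]
          gcongr
          exact Measure.restrict_le_self
      _ = _ := by
          rw [Measure.addHaar_ball _ _ hε.le, Measure.addHaar_closedBall _ _ hR,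
            finrank_euclideanSpace_fin, mul_comm, ← div_eq_mul_inv,
            ENNReal.mul_div_mul_right _ _ hv0 hvt, div_pow,
            ENNReal.ofReal_div_of_pos (by positivity)]
  have hbound : ∀ D : Set ℝ, IsLowerSet D → MeasurableSet D → (P • κ.map norm) D ≤
      ENNReal.ofReal (2 * (2 * d + 3) ^ d) * ((μ.prod μ).map (fun p => dist p.1 p.2)) D := by
    intro D hD hDm
    rw [Measure.smul_apply, smul_eq_mul, Measure.map_apply (by fun_prop) hDm,
      Measure.map_apply (by fun_prop) hDm]
    rcases D.eq_empty_or_nonempty with rfl | ⟨a, ha⟩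
    · simp
    have hne : (D ∩ Iio ε).Nonempty :=
      ⟨min a (ε - 1), hD (min_le_left _ _) ha, (min_le_right _ _).trans_lt (sub_one_lt ε)⟩
    have hb : BddAbove (D ∩ Iio ε) := ⟨ε, fun r hr => hr.2.le⟩
    set R := sSup (D ∩ Iio ε)
    have hRε : R ≤ ε := csSup_le hne fun r hr => hr.2.le
    have hκD : κ (norm ⁻¹' D) ≤ κ (Metric.closedBall 0 R) := by
      refine measure_mono_ae (ae_cond_ball_norm_lt.mono fun u hu huD => ?_)
      exact mem_closedBall_zero_iff.2 (le_csSup hb ⟨huD, hu⟩)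
    rcases le_or_gt R 0 with hR | hR
    · have : κ (norm ⁻¹' D) = 0 := by
        refine le_antisymm (hκD.trans ((measure_mono
          (Metric.closedBall_subset_closedBall hR)).trans ?_)) bot_le
        refine (hclosed 0 le_rfl).trans ?_
        simp [show d ≠ 0 by omega]
      simp [this]
    · have h1 : P ≤ ENNReal.ofReal (2 * ((2 * d + 3) * (ε / R)) ^ d) *
          (μ.prod μ) {p | dist p.1 p.2 < R} :=
        (measure_mono <| ofPred_subset_ofPred.2 fun _ hp => hp.le).trans
          (prod_self_dist_le_le hd μ hR hRε)
      have h2 : (μ.prod μ) {p | dist p.1 p.2 < R} ≤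
          (μ.prod μ) ((fun p => dist p.1 p.2) ⁻¹' D) := by
        refine measure_mono fun p hp => ?_
        obtain ⟨r, hr, hpr⟩ := exists_lt_of_lt_csSup hne hp
        exact hD hpr.le hr.1
      calc P * κ (norm ⁻¹' D)
          ≤ (ENNReal.ofReal (2 * ((2 * d + 3) * (ε / R)) ^ d) *
            (μ.prod μ) ((fun p => dist p.1 p.2) ⁻¹' D)) * ENNReal.ofReal ((R / ε) ^ d) := by
            gcongr
            · exact h1.trans (by gcongr)
            · exact hκD.trans (hclosed R hR.le)
        _ = _ := by
            rw [mul_right_comm, ← ENNReal.ofReal_mul (by positivity)]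
            congr 2
            rw [mul_assoc, ← mul_pow]
            field_simp
  have := lintegral_le_mul_lintegral_of_isLowerSet ENNReal.ofReal_ne_top hbound hf
  rwa [lintegral_smul_measure, lintegral_map hfm (by fun_prop),
    ← kernelAvg_eq_lintegral_cond hd hfm hε, smul_eq_mul,
    ← energy_eq_lintegral_map_dist μ hfm] at this

theorem energy_smoothedKernel_le (hd : 1 ≤ d) {f : ℝ → ℝ≥0∞} (hf : Antitone f) {ε : ℝ}
    (hε : 0 < ε) (μ : Measure (EuclideanSpace ℝ (Fin d))) [IsFiniteMeasure μ] :
    energy (smoothedKernel d f ε) μ ≤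
      ENNReal.ofReal (2 * (2 * d + 3) ^ d + 1) * energy f μ := by
  have hfm := hf.measurable
  set β := (μ.prod μ).map (fun p => dist p.1 p.2) with hβ
  calc energy (smoothedKernel d f ε) μ = ∫⁻ r, smoothedKernel d f ε r ∂β :=
        energy_eq_lintegral_map_dist μ (antitone_smoothedKernel hd hf hε).measurable
    _ ≤ ∫⁻ r, ((Iio ε).indicator (fun _ => kernelAvg d f ε) r + f r) ∂β := by
        refine lintegral_mono fun r => ?_
        by_cases h : r < ε <;> simp [smoothedKernel, h]
    _ = (μ.prod μ) {p | dist p.1 p.2 < ε} * kernelAvg d f ε + energy f μ := by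
        rw [lintegral_add_right _ hfm, lintegral_indicator_const measurableSet_Iio,
          energy_eq_lintegral_map_dist μ hfm, hβ,
          Measure.map_apply (by fun_prop) measurableSet_Iio, mul_comm]
        rfl
    _ ≤ ENNReal.ofReal (2 * (2 * d + 3) ^ d) * energy f μ + energy f μ := by
        gcongr ?_ + _
        exact kernelAvg_mul_measure_le hd hf hε μ
    _ = _ := by
        rw [ENNReal.ofReal_add (by positivity) zero_le_one, ENNReal.ofReal_one, add_mul, one_mul]

/-- A measurable approximate projection of a thickening onto the set. -/
theorem exists_measurable_dist_lt_of_mem_thickening (hd : 1 ≤ d) {ε : ℝ} (hε : 0 < ε)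
    {Λ : Set (EuclideanSpace ℝ (Fin d))} (hΛ : Λ.Nonempty) :
    ∃ φ : EuclideanSpace ℝ (Fin d) → EuclideanSpace ℝ (Fin d), Measurable φ ∧
      (∀ x, φ x ∈ Λ) ∧ ∀ x ∈ Metric.thickening ε Λ, dist x (φ x) < 2 * ε := by
  have hd' : (0 : ℝ) < d := by exact_mod_cast hd
  have hs : 0 < ε / d := by positivity
  have hex : ∀ k : Fin d → ℤ, ∃ y ∈ Λ, ∀ x ∈ Metric.thickening ε Λ,
      gridCell (ε / d) x = k → dist x y < 2 * ε := by
    intro k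
    by_cases h : ∃ x ∈ Metric.thickening ε Λ, gridCell (ε / d) x = k
    · obtain ⟨x, hx, rfl⟩ := h
      obtain ⟨y, hy, hxy⟩ := Metric.mem_thickening_iff.1 hx
      refine ⟨y, hy, fun x' _ hx' => ?_⟩
      have h1 := dist_lt_of_gridCell_eq hd hs hx'
      rw [mul_div_cancel₀ _ hd'.ne'] at h1
      linarith [dist_triangle x' x y]
    · obtain ⟨y, hy⟩ := hΛ
      exact ⟨y, hy, fun x hx hk => absurd ⟨x, hx, hk⟩ h⟩
  choose y hy hdist using hex
  exact ⟨fun x => y (gridCell (ε / d) x),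
    (measurable_of_countable y).comp (measurable_gridCell _),
    fun x => hy _, fun x hx => hdist _ x hx rfl⟩

theorem energy_smoothedKernel_map_le (hd : 1 ≤ d) {f : ℝ → ℝ≥0∞} (hf : Antitone f) {ε : ℝ}
    (hε : 0 < ε) (μ : Measure (EuclideanSpace ℝ (Fin d))) [SFinite μ]
    {φ : EuclideanSpace ℝ (Fin d) → EuclideanSpace ℝ (Fin d)} (hφ : Measurable φ)
    (h : ∀ᵐ x ∂μ, dist x (φ x) < 2 * ε) :
    energy (smoothedKernel d f ε) (μ.map φ) ≤
      energy (fun r => smoothedKernel d f ε (r / 5)) μ := by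
  have hg := antitone_smoothedKernel hd hf hε
  have hgm := hg.measurable
  have hm : Measurable fun z : EuclideanSpace ℝ (Fin d) =>
      ∫⁻ w, smoothedKernel d f ε (dist z w) ∂μ.map φ :=
    Measurable.lintegral_prod_right' (f := fun p : EuclideanSpace ℝ (Fin d) ×
      EuclideanSpace ℝ (Fin d) => smoothedKernel d f ε (dist p.1 p.2)) (by fun_prop)
  unfold energy
  rw [lintegral_map hm hφ]
  refine lintegral_mono_ae (h.mono fun x hx => ?_)
  rw [lintegral_map (by fun_prop) hφ]
  refine lintegral_mono_ae (h.mono fun y hy => ?_)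
  have htri : dist x y ≤ dist (φ x) (φ y) + 4 * ε := by
    have := dist_triangle4 x (φ x) (φ y) y
    rw [dist_comm (φ y) y] at this
    linarith
  rcases lt_or_ge (dist (φ x) (φ y)) ε with hr | hr
  · have h5 : dist x y / 5 < ε := by linarith
    simp [smoothedKernel, hr, h5]
  · exact hg (by linarith)

end Smoothing

theorem capacity_le_mul_capacity {X : Type*} [MeasurableSpace X] [PseudoMetricSpace X]
    {f g : ℝ → ℝ≥0∞} {Λ Λ' : Set X} {C : ℝ≥0} (hC : 0 < C)
    (h : ∀ ν : Measure X, IsProbabilityMeasure ν → ν Λ = 1 →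
      ∃ ν' : Measure X, IsProbabilityMeasure ν' ∧ ν' Λ' = 1 ∧ energy g ν' ≤ C * energy f ν) :
    capacity f Λ ≤ C * capacity g Λ' := by
  have hC0 : (C : ℝ≥0∞) ≠ 0 := by exact_mod_cast hC.ne'
  unfold capacity
  set a := ⨅ (ν : Measure X) (_ : IsProbabilityMeasure ν) (_ : ν Λ = 1), energy f ν
  set b := ⨅ (ν : Measure X) (_ : IsProbabilityMeasure ν) (_ : ν Λ' = 1), energy g ν
  have hba : (C : ℝ≥0∞)⁻¹ * b ≤ a := by
    refine le_iInf fun ν => le_iInf fun hν => le_iInf fun hνΛ => ?_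
    obtain ⟨ν', hν', hνΛ', hE⟩ := h ν hν hνΛ
    rw [ENNReal.inv_mul_le_iff hC0 ENNReal.coe_ne_top]
    exact (iInf_le_of_le ν' (iInf_le_of_le hν' (iInf_le _ hνΛ'))).trans hE
  calc a⁻¹ ≤ ((C : ℝ≥0∞)⁻¹ * b)⁻¹ := ENNReal.inv_le_inv.2 hba
    _ = C * b⁻¹ := by
        rw [ENNReal.mul_inv (.inl (ENNReal.inv_ne_zero.2 ENNReal.coe_ne_top))
          (.inl (ENNReal.inv_ne_top.2 hC0)), inv_inv]

theorem capacity_comp_max_zero {X : Type*} [MeasurableSpace X] [PseudoMetricSpace X]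
    (f : ℝ → ℝ≥0∞) (Λ : Set X) : capacity (fun r => f (max r 0)) Λ = capacity f Λ := by
  simp [capacity, energy]

theorem smoothedKernel_comp_max_zero (d : ℕ) (f : ℝ → ℝ≥0∞) {ε : ℝ} (hε : 0 < ε) :
    smoothedKernel d (fun r => f (max r 0)) ε = smoothedKernel d f ε := by
  have havg : kernelAvg d (fun r => f (max r 0)) ε = kernelAvg d f ε := by
    unfold kernelAvg
    congr 1
    refine setLIntegral_congr_fun measurableSet_Ioo fun s hs => ?_
    simp only [max_eq_left hs.1.le]
  ext r
  unfold smoothedKernel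
  split_ifs with h
  · exact havg
  · simp only [max_eq_left (hε.le.trans (not_lt.1 h))]

theorem capacity_smoothedKernel_le {d : ℕ} (hd : 1 ≤ d)
    {Λ : Set (EuclideanSpace ℝ (Fin d))} (hΛ : MeasurableSet Λ) {f : ℝ → ℝ≥0∞}
    (hf : Antitone f) {ε : ℝ} (hε : 0 < ε) :
    capacity (smoothedKernel d f ε) Λ ≤
      (Real.toNNReal (2 * ((2 * d + 3) * 4) ^ d) : ℝ≥0∞) *
        capacity f (Metric.thickening ε Λ) := by
  refine capacity_le_mul_capacity (Real.toNNReal_pos.2 (by positivity)) fun ν hν hνΛ => ?_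
  have hprob := isProbabilityMeasure_cond_ball (d := d) hε
  exact ⟨_, inferInstance, conv_cond_ball_thickening hε hΛ ν hνΛ,
    (energy_conv_cond_ball_le hd hf hε ν).trans
      (energy_div_le hd ν (antitone_smoothedKernel hd hf hε) (by norm_num))⟩

theorem capacity_thickening_le {d : ℕ} (hd : 1 ≤ d)
    {Λ : Set (EuclideanSpace ℝ (Fin d))} (hΛ : MeasurableSet Λ) {f : ℝ → ℝ≥0∞}
    (hf : Antitone f) {ε : ℝ} (hε : 0 < ε) :
    capacity f (Metric.thickening ε Λ) ≤
      (Real.toNNReal (2 * ((2 * d + 3) * 5) ^ d * (2 * (2 * d + 3) ^ d + 1)) : ℝ≥0∞) *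
        capacity (smoothedKernel d f ε) Λ := by
  refine capacity_le_mul_capacity (Real.toNNReal_pos.2 (by positivity)) fun μ hμ hμΛ => ?_
  have hne : Λ.Nonempty := by
    rw [nonempty_iff_ne_empty]
    rintro rfl
    simp at hμΛ
  obtain ⟨φ, hφ, hφΛ, hdist⟩ := exists_measurable_dist_lt_of_mem_thickening hd hε hne
  have hae : ∀ᵐ x ∂μ, x ∈ Metric.thickening ε Λ :=
    (mem_ae_iff_prob_eq_one Metric.isOpen_thickening.measurableSet).2 hμΛ
  refine ⟨μ.map φ, Measure.isProbabilityMeasure_map hφ.aemeasurable, ?_, ?_⟩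
  · rw [Measure.map_apply hφ hΛ, (eq_univ_of_forall hφΛ : φ ⁻¹' Λ = univ), measure_univ]
  · calc _ ≤ energy (fun r => smoothedKernel d f ε (r / 5)) μ :=
          energy_smoothedKernel_map_le hd hf hε μ hφ (hae.mono hdist)
      _ ≤ ENNReal.ofReal (2 * ((2 * d + 3) * 5) ^ d) * energy (smoothedKernel d f ε) μ :=
          energy_div_le hd μ (antitone_smoothedKernel hd hf hε) (by norm_num)
      _ ≤ ENNReal.ofReal (2 * ((2 * d + 3) * 5) ^ d) *
            (ENNReal.ofReal (2 * (2 * d + 3) ^ d + 1) * energy f μ) := by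
          gcongr
          exact energy_smoothedKernel_le hd hf hε μ
      _ = _ := by
          rw [← mul_assoc, ← ENNReal.ofReal_mul (by positivity)]
          rfl

/-- **Capacity of a sausage and the smoothed kernel** (Proposition 4.1): there are
constants `0 < c₁(d), c₂(d)` (independent of `Λ`, `f`, `ε`) such that for every Borel set
`Λ ⊆ ℝ^d`, every decreasing kernel `f` with `Cap_f(ℝ^d) > 0`, and every `ε > 0`,
`Cap_f(Λ_ε) ≍ Cap_{f_ε}(Λ)`, where `Λ_ε` is the open `ε`-sausage about `Λ`. -/
theorem sausage_capacity_equivalence (d : ℕ) (hd : 1 ≤ d) :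
    ∃ c₁ c₂ : ℝ≥0, 0 < c₁ ∧ 0 < c₂ ∧
      ∀ (Λ : Set (EuclideanSpace ℝ (Fin d))), MeasurableSet Λ →
      ∀ f : ℝ → ℝ≥0∞, IsKernel f →
        0 < capacity f (Set.univ : Set (EuclideanSpace ℝ (Fin d))) →
      ∀ ε : ℝ, 0 < ε →
        (c₁ : ℝ≥0∞) * capacity (smoothedKernel d f ε) Λ ≤
            capacity f (Metric.thickening ε Λ) ∧
          capacity f (Metric.thickening ε Λ) ≤
            (c₂ : ℝ≥0∞) * capacity (smoothedKernel d f ε) Λ := by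
  refine ⟨(Real.toNNReal (2 * ((2 * d + 3) * 4) ^ d))⁻¹,
    Real.toNNReal (2 * ((2 * d + 3) * 5) ^ d * (2 * (2 * d + 3) ^ d + 1)),
    inv_pos.2 (Real.toNNReal_pos.2 (by positivity)), Real.toNNReal_pos.2 (by positivity),
    fun Λ hΛ f hf _ ε hε => ?_⟩
  have hanti : Antitone fun r => f (max r 0) := fun a b hab =>
    hf.1 (le_max_right a 0) (le_max_right b 0) (max_le_max_right 0 hab)
  have h1 := capacity_smoothedKernel_le hd hΛ hanti hε
  have h2 := capacity_thickening_le hd hΛ hanti hε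
  rw [capacity_comp_max_zero, smoothedKernel_comp_max_zero d f hε] at h1 h2
  have hpos : 0 < Real.toNNReal (2 * ((2 * d + 3) * 4) ^ d) :=
    Real.toNNReal_pos.2 (by positivity)
  refine ⟨?_, h2⟩
  rw [ENNReal.coe_inv hpos.ne', ENNReal.inv_mul_le_iff (by exact_mod_cast hpos.ne')
    ENNReal.coe_ne_top]
  exact h1
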